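/- arXiv:2009.13607 — 2 statements merged into one kernel-verified Lean document; each statement's English description precedes it below -/
import Mathlib

section
/- For every real x > 0, |J₀(x)| ≤ √(2/(πx)); moreover |J₀(x)| ≤ 1 for every x ≥ 0. -/
noncomputable section

/-- The Bessel function of order zero, via its integral representation
`J₀(x) = (1/2π) ∫₀^{2π} cos (x sin t) dt` (the real form of
`(1/2π) ∫₀^{2π} e^{-i x sin t} dt`). -/
def besselJ0 (x : ℝ) : ℝ :=
  (1 / (2 * Real.pi)) * ∫ t in (0 : ℝ)..(2 * Real.pi), Real.cos (x * Real.sin t)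

open Set Filter Topology MeasureTheory

theorem integral_cos_mul_sin_eq_four_mul (x : ℝ) :
    ∫ t in (0 : ℝ)..(2 * Real.pi), Real.cos (x * Real.sin t) =
      4 * ∫ t in (0 : ℝ)..(Real.pi / 2), Real.cos (x * Real.cos t) := by
  have hi (a b : ℝ) :
      IntervalIntegrable (fun t => Real.cos (x * Real.sin t)) volume a b :=
    (by fun_prop : Continuous fun t => Real.cos (x * Real.sin t)).intervalIntegrable a b
  have shift : ∫ t in (0 : ℝ)..Real.pi, Real.cos (x * Real.sin t) =
      ∫ t in Real.pi..(2 * Real.pi), Real.cos (x * Real.sin t) := by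
    have h := intervalIntegral.integral_comp_add_right (a := 0) (b := Real.pi)
      (fun t => Real.cos (x * Real.sin t)) Real.pi
    simpa [← two_mul] using h
  have reflect : ∫ t in (0 : ℝ)..(Real.pi / 2), Real.cos (x * Real.sin t) =
      ∫ t in (Real.pi / 2)..Real.pi, Real.cos (x * Real.sin t) := by
    have h := intervalIntegral.integral_comp_sub_left (a := 0) (b := Real.pi / 2)
      (fun t => Real.cos (x * Real.sin t)) Real.pi
    simpa [Real.sin_pi_sub, sub_half] using h
  have compl : ∫ t in (0 : ℝ)..(Real.pi / 2), Real.cos (x * Real.cos t) =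
      ∫ t in (0 : ℝ)..(Real.pi / 2), Real.cos (x * Real.sin t) := by
    have h := intervalIntegral.integral_comp_sub_left (a := 0) (b := Real.pi / 2)
      (fun t => Real.cos (x * Real.sin t)) (Real.pi / 2)
    simpa [Real.sin_pi_div_two_sub] using h
  have split := intervalIntegral.integral_add_adjacent_intervals
    (hi 0 Real.pi) (hi Real.pi (2 * Real.pi))
  have split' := intervalIntegral.integral_add_adjacent_intervals
    (hi 0 (Real.pi / 2)) (hi (Real.pi / 2) Real.pi)
  linarith

theorem besselJ0_eq_integral_cos (x : ℝ) :
    besselJ0 x = (2 / Real.pi) * ∫ t in (0 : ℝ)..(Real.pi / 2), Real.cos (x * Real.cos t) := by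
  rw [besselJ0, integral_cos_mul_sin_eq_four_mul]
  field_simp
  ring

theorem abs_besselJ0_le_one (x : ℝ) : |besselJ0 x| ≤ 1 := by
  have h := intervalIntegral.norm_integral_le_of_norm_le_const (a := 0) (b := 2 * Real.pi)
    (f := fun t => Real.cos (x * Real.sin t)) (C := 1) fun t _ => Real.abs_cos_le_one _
  have hpi := Real.pi_pos
  rw [Real.norm_eq_abs, sub_zero, one_mul, abs_of_pos (by positivity : 0 < 2 * Real.pi)] at h
  rw [besselJ0, abs_mul, abs_of_pos (by positivity), one_div, inv_mul_le_iff₀ (by positivity)]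
  linarith

theorem norm_cexp_mul_cos_mul_I (x a b : ℝ) :
    ‖Complex.exp (x * Complex.cos (a - b * Complex.I) * Complex.I)‖ =
      Real.exp (-(x * (Real.sin a * Real.sinh b))) := by
  rw [Complex.norm_exp, Complex.cos_sub, Complex.cos_mul_I, Complex.sin_mul_I,
    ← Complex.ofReal_cos, ← Complex.ofReal_sin, ← Complex.ofReal_cosh, ← Complex.ofReal_sinh]
  simp [-Complex.ofReal_cos, -Complex.ofReal_sin, -Complex.ofReal_cosh, -Complex.ofReal_sinh]

theorem intervalIntegral_gaussian_le {x r : ℝ} (hx : 0 < x) (hr : 0 ≤ r) :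
    ∫ t in (0 : ℝ)..r, Real.exp (-x * t ^ 2) ≤ √(Real.pi / x) / 2 := by
  rw [← integral_gaussian_Ioi, intervalIntegral.integral_of_le hr]
  exact setIntegral_mono_set (integrable_exp_neg_mul_sq hx).integrableOn
    (ae_of_all _ fun t => (Real.exp_pos _).le) Ioc_subset_Ioi_self.eventuallyLE

theorem cos_arctan_sinh (b : ℝ) : Real.cos (Real.arctan (Real.sinh b)) = 1 / Real.cosh b := by
  rw [Real.cos_arctan, add_comm, ← Real.cosh_sq, Real.sqrt_sq (Real.cosh_pos b).le]

theorem sin_arctan_sinh (b : ℝ) :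
    Real.sin (Real.arctan (Real.sinh b)) = Real.sinh b / Real.cosh b := by
  rw [Real.sin_arctan, add_comm, ← Real.cosh_sq, Real.sqrt_sq (Real.cosh_pos b).le]

theorem hasDerivAt_arctan_sinh (b : ℝ) :
    HasDerivAt (fun b => Real.arctan (Real.sinh b)) (1 / Real.cosh b) b := by
  have h := (Real.hasDerivAt_sinh b).arctan
  have hc := Real.cosh_pos b
  refine h.congr_deriv ?_
  rw [add_comm, ← Real.cosh_sq]
  field_simp

theorem hasDerivAt_sinh_div_sqrt_cosh (b : ℝ) :
    HasDerivAt (fun b => Real.sinh b / √(Real.cosh b))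
      ((Real.cosh b ^ 2 + 1) / (2 * Real.cosh b * √(Real.cosh b))) b := by
  have hc := Real.cosh_pos b
  have hs : √(Real.cosh b) ^ 2 = Real.cosh b := Real.sq_sqrt hc.le
  have hs0 : 0 < √(Real.cosh b) := Real.sqrt_pos.mpr hc
  have h := (Real.hasDerivAt_sinh b).div ((Real.hasDerivAt_cosh b).sqrt hc.ne') hs0.ne'
  refine h.congr_deriv ?_
  have hcs := Real.cosh_sq b
  rw [div_eq_div_iff (by positivity) (by positivity), hs]
  field_simp
  rw [hs]
  linear_combination hcs

theorem norm_inv_cosh_sub_I_le (b : ℝ) :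
    ‖((1 / Real.cosh b : ℝ) : ℂ) - Complex.I‖ ≤
      √2 * ((Real.cosh b ^ 2 + 1) / (2 * Real.cosh b * √(Real.cosh b))) := by
  have hc := Real.cosh_pos b
  have hs : √(Real.cosh b) ^ 2 = Real.cosh b := Real.sq_sqrt hc.le
  refine le_of_sq_le_sq ?_ (by positivity)
  rw [Complex.sq_norm, Complex.normSq_apply, mul_pow, div_pow, mul_pow, hs, Real.sq_sqrt (by simp)]
  simp only [Complex.sub_re, Complex.ofReal_re, Complex.I_re, Complex.sub_im, Complex.ofReal_im,
    Complex.I_im]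
  rw [← sub_nonneg]
  have key : 2 * ((Real.cosh b ^ 2 + 1) ^ 2 / ((2 * Real.cosh b) ^ 2 * Real.cosh b)) -
      ((1 / Real.cosh b - 0) * (1 / Real.cosh b - 0) + (0 - 1) * (0 - 1)) =
      (Real.cosh b ^ 2 + 1) * (Real.cosh b - 1) ^ 2 / (2 * Real.cosh b ^ 3) := by
    field_simp
    ring
  rw [key]
  positivity

section Primitive

variable {F : ℂ → ℂ} {x : ℝ}

theorem hasDerivAt_comp_vertical
    (hF : ∀ z, HasDerivAt F (Complex.exp (x * Complex.cos z * Complex.I)) z)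
    {g : ℝ → ℝ} {g' b : ℝ} (hg : HasDerivAt g g' b) :
    HasDerivAt (fun b : ℝ => F (g b - b * Complex.I))
      (Complex.exp (x * Complex.cos (g b - b * Complex.I) * Complex.I) * (g' - Complex.I)) b := by
  have h : HasDerivAt (fun b : ℝ => (g b : ℂ) - b * Complex.I) (g' - Complex.I) b := by
    exact (hg.ofReal_comp.sub ((hasDerivAt_id b).ofReal_comp.mul_const Complex.I)).congr_deriv
      (by simp)
  exact (hF _).comp b h

/-- The bound along the path of steepest descent `b ↦ arctan (sinh b) - b i` from `0`. -/
theorem norm_primitive_steepest_descent_le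
    (hF : ∀ z, HasDerivAt F (Complex.exp (x * Complex.cos z * Complex.I)) z)
    (hx : 0 < x) {b : ℝ} (hb : 0 ≤ b) :
    ‖F (Real.arctan (Real.sinh b) - b * Complex.I) - F 0‖ ≤ √2 * (√(Real.pi / x) / 2) := by
  have hd (t : ℝ) := hasDerivAt_comp_vertical hF (hasDerivAt_arctan_sinh t)
  have hB (t : ℝ) : HasDerivAt
      (fun t => √2 * ∫ u in (0 : ℝ)..(Real.sinh t / √(Real.cosh t)), Real.exp (-x * u ^ 2))
      (√2 * (Real.exp (-x * (Real.sinh t / √(Real.cosh t)) ^ 2) *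
        ((Real.cosh t ^ 2 + 1) / (2 * Real.cosh t * √(Real.cosh t))))) t := by
    have hcont : Continuous fun u : ℝ => Real.exp (-x * u ^ 2) := by fun_prop
    exact ((hcont.integral_hasStrictDerivAt 0 _).hasDerivAt.comp t
      (hasDerivAt_sinh_div_sqrt_cosh t)).const_mul _
  have h := image_norm_le_of_norm_deriv_right_le_deriv_boundary (a := 0) (b := b)
    (fun t _ => ((hd t).sub_const (F 0)).continuousAt.continuousWithinAt)
    (fun t _ => ((hd t).sub_const (F 0)).hasDerivWithinAt) (by simp) hB
    (fun t _ => ?_) (right_mem_Icc.mpr hb)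
  · refine h.trans ?_
    gcongr
    exact intervalIntegral_gaussian_le hx (div_nonneg (Real.sinh_nonneg_iff.mpr hb) (by positivity))
  · have he : -(x * (Real.sinh t / Real.cosh t * Real.sinh t)) =
        -x * (Real.sinh t / √(Real.cosh t)) ^ 2 := by
      rw [div_pow, Real.sq_sqrt (Real.cosh_pos t).le]
      ring
    rw [norm_mul, norm_cexp_mul_cos_mul_I, sin_arctan_sinh, he, mul_left_comm]
    gcongr
    exact norm_inv_cosh_sub_I_le t

theorem re_primitive_pi_div_two_sub_mul_I
    (hF : ∀ z, HasDerivAt F (Complex.exp (x * Complex.cos z * Complex.I)) z) (b : ℝ) :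
    (F ((Real.pi / 2 : ℝ) - b * Complex.I)).re = (F (Real.pi / 2 : ℝ)).re := by
  have hd (t : ℝ) : HasDerivAt
      (fun t : ℝ => (F ((Real.pi / 2 : ℝ) - t * Complex.I)).re) 0 t := by
    have h := hasDerivAt_comp_vertical hF (hasDerivAt_const t (Real.pi / 2))
    have h' := Complex.reCLM.hasFDerivAt.comp_hasDerivAt t h
    refine h'.congr_deriv ?_
    have : x * Complex.cos ((Real.pi / 2 : ℝ) - t * Complex.I) * Complex.I =
        ((-(x * Real.sinh t) : ℝ) : ℂ) := by
      rw [Complex.ofReal_div, Complex.ofReal_ofNat, Complex.cos_pi_div_two_sub, Complex.sin_mul_I]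
      push_cast
      linear_combination (x * Complex.sinh t) * Complex.I_mul_I
    rw [this, ← Complex.ofReal_exp]
    simp [-Complex.ofReal_exp]
  simpa using is_const_of_deriv_eq_zero (fun t => (hd t).differentiableAt)
    (fun t => (hd t).deriv) b 0

theorem norm_primitive_horizontal_le
    (hF : ∀ z, HasDerivAt F (Complex.exp (x * Complex.cos z * Complex.I)) z)
    (hx : 0 < x) {b : ℝ} (hb : 0 ≤ b) :
    ‖F ((Real.pi / 2 : ℝ) - b * Complex.I) - F (Real.arctan (Real.sinh b) - b * Complex.I)‖ ≤
      Real.exp (-(x * (b - 1))) * (Real.pi / 2) := by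
  have hd (a : ℝ) : HasDerivAt (fun a : ℝ => F (a - b * Complex.I))
      (Complex.exp (x * Complex.cos (a - b * Complex.I) * Complex.I)) a := by
    have h : HasDerivAt (fun a : ℝ => (a : ℂ) - b * Complex.I) 1 a := by
      simpa using (hasDerivAt_id a).ofReal_comp.sub_const (b * Complex.I)
    exact ((hF _).comp a h).congr_deriv (mul_one _)
  have hs : 0 ≤ Real.sinh b := Real.sinh_nonneg_iff.mpr hb
  have ha0 : 0 ≤ Real.arctan (Real.sinh b) := Real.arctan_nonneg.mpr hs
  have hal := (Real.arctan_lt_pi_div_two (Real.sinh b)).le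
  refine (norm_image_sub_le_of_norm_deriv_le_segment' (fun a _ => (hd a).hasDerivWithinAt)
    (C := Real.exp (-(x * (b - 1)))) (fun a ha => ?_) _ (right_mem_Icc.mpr hal)).trans ?_
  · rw [norm_cexp_mul_cos_mul_I]
    have hsin : Real.sinh b / Real.cosh b ≤ Real.sin a := by
      rw [← sin_arctan_sinh]
      exact Real.sin_le_sin_of_le_of_le_pi_div_two (by linarith [Real.pi_pos]) ha.2.le ha.1
    have hc := Real.one_le_cosh b
    have hle : b - 1 ≤ Real.sinh b / Real.cosh b * Real.sinh b := by
      have h1 : b ≤ Real.sinh b := Real.self_le_sinh_iff.mpr hb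
      have h2 := Real.sinh_lt_cosh b
      have h3 : Real.sinh b / Real.cosh b * Real.sinh b = Real.cosh b - 1 / Real.cosh b := by
        have := Real.cosh_sq b
        field_simp
        linarith
      have h4 : 1 / Real.cosh b ≤ 1 := by
        rw [div_le_one (by positivity)]
        exact hc
      linarith
    gcongr
    exact hle.trans (by gcongr)
  · gcongr
    linarith

theorem re_primitive_sub_eq_integral
    (hF : ∀ z, HasDerivAt F (Complex.exp (x * Complex.cos z * Complex.I)) z) :
    (F (Real.pi / 2 : ℝ)).re - (F 0).re =
      ∫ t in (0 : ℝ)..(Real.pi / 2), Real.cos (x * Real.cos t) := by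
  have hd (t : ℝ) : HasDerivAt (fun t : ℝ => (F t).re) (Real.cos (x * Real.cos t)) t := by
    have h := Complex.reCLM.hasFDerivAt.comp_hasDerivAt t (hF t).comp_ofReal
    refine h.congr_deriv ?_
    rw [← Complex.ofReal_cos, ← Complex.ofReal_mul]
    exact Complex.exp_ofReal_mul_I_re _
  rw [intervalIntegral.integral_eq_sub_of_hasDerivAt (fun t _ => hd t)
    ((by fun_prop : Continuous fun t => Real.cos (x * Real.cos t)).intervalIntegrable _ _),
    Complex.ofReal_zero]

end Primitive

theorem abs_integral_cos_mul_cos_le {x : ℝ} (hx : 0 < x) :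
    |∫ t in (0 : ℝ)..(Real.pi / 2), Real.cos (x * Real.cos t)| ≤ √2 * (√(Real.pi / x) / 2) := by
  have hdiff : Differentiable ℂ fun z : ℂ => Complex.exp (x * Complex.cos z * Complex.I) := by
    fun_prop
  obtain ⟨F, hF⟩ := hdiff.isExactOn_univ
  replace hF (z : ℂ) := hF z (mem_univ z)
  have bound : ∀ b : ℝ, 0 ≤ b →
      |∫ t in (0 : ℝ)..(Real.pi / 2), Real.cos (x * Real.cos t)| ≤
        √2 * (√(Real.pi / x) / 2) + Real.exp (-(x * (b - 1))) * (Real.pi / 2) := by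
    intro b hb
    rw [← re_primitive_sub_eq_integral hF, ← re_primitive_pi_div_two_sub_mul_I hF b,
      ← Complex.sub_re, ← sub_add_sub_cancel' (F (Real.arctan (Real.sinh b) - b * Complex.I))]
    exact (Complex.abs_re_le_norm _).trans ((norm_add_le _ _).trans
      (add_le_add (norm_primitive_steepest_descent_le hF hx hb)
        (norm_primitive_horizontal_le hF hx hb)))
  have lim : Tendsto (fun b : ℝ =>
      √2 * (√(Real.pi / x) / 2) + Real.exp (-(x * (b - 1))) * (Real.pi / 2)) atTop
      (𝓝 (√2 * (√(Real.pi / x) / 2))) := by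
    have h : Tendsto (fun b : ℝ => Real.exp (-(x * (b - 1)))) atTop (𝓝 0) :=
      Real.tendsto_exp_neg_atTop_nhds_zero.comp
        ((tendsto_atTop_add_const_right atTop (-1) tendsto_id).const_mul_atTop hx)
    simpa using (h.mul_const (Real.pi / 2)).const_add (√2 * (√(Real.pi / x) / 2))
  exact ge_of_tendsto lim ((eventually_ge_atTop 0).mono bound)

theorem abs_besselJ0_le_sqrt {x : ℝ} (hx : 0 < x) : |besselJ0 x| ≤ √(2 / (Real.pi * x)) := by
  have hpi := Real.pi_pos
  rw [besselJ0_eq_integral_cos, abs_mul, abs_of_pos (by positivity)]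
  calc (2 / Real.pi) * |∫ t in (0 : ℝ)..(Real.pi / 2), Real.cos (x * Real.cos t)|
      ≤ (2 / Real.pi) * (√2 * (√(Real.pi / x) / 2)) := by
        gcongr
        exact abs_integral_cos_mul_cos_le hx
    _ = √(2 / (Real.pi * x)) := by
        symm
        rw [Real.sqrt_eq_iff_mul_self_eq (by positivity) (by positivity)]
        ring_nf
        rw [Real.sq_sqrt (by positivity), Real.sq_sqrt (by positivity)]
        field_simp

/-- `|J₀(x)| ≤ √(2/(πx))` for `x > 0`, and `|J₀(x)| ≤ 1` for `x ≥ 0`. -/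
theorem besselJ0_bounds :
    (∀ x : ℝ, 0 < x → |besselJ0 x| ≤ Real.sqrt (2 / (Real.pi * x))) ∧
    (∀ x : ℝ, 0 ≤ x → |besselJ0 x| ≤ 1) := by
  exact ⟨fun _ hx => abs_besselJ0_le_sqrt hx, fun x _ => abs_besselJ0_le_one x⟩
end
end

section
/- Define J₀ : ℝ → ℝ by J₀(x) = (1/2π)∫₀^{2π} cos(x sin t) dt. Then J₀ is twice differentiable on ℝ, J₀(0) = 1, J₀'(0) = 0, and x·J₀''(x) + J₀'(x) + x·J₀(x) = 0 for every x ∈ ℝ. -/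
noncomputable section

theorem hasDerivAt_intervalIntegral_of_norm_deriv_le {F F' : ℝ → ℝ → ℝ} {a b C : ℝ}
    (hF : ∀ x, Continuous (F x)) (hF' : ∀ x, Continuous (F' x))
    (h_bound : ∀ x t, ‖F' x t‖ ≤ C)
    (h_diff : ∀ x t, HasDerivAt (fun y => F y t) (F' x t) x) (x : ℝ) :
    HasDerivAt (fun y => ∫ t in a..b, F y t) (∫ t in a..b, F' x t) x :=
  (intervalIntegral.hasDerivAt_integral_of_dominated_loc_of_deriv_le
    (bound := fun _ => C) (s := Set.univ) Filter.univ_mem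
    (.of_forall fun y => (hF y).aestronglyMeasurable)
    ((hF x).intervalIntegrable a b) (hF' x).aestronglyMeasurable
    (.of_forall fun t _ y _ => h_bound y t) intervalIntegrable_const
    (.of_forall fun t _ y _ => h_diff y t)).2

theorem hasDerivAt_besselJ0 (x : ℝ) :
    HasDerivAt besselJ0 ((1 / (2 * Real.pi)) *
      ∫ t in (0 : ℝ)..(2 * Real.pi), -(Real.sin t * Real.sin (x * Real.sin t))) x := by
  refine HasDerivAt.const_mul _ (hasDerivAt_intervalIntegral_of_norm_deriv_le (C := 1)
    (F := fun x t => Real.cos (x * Real.sin t))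
    (F' := fun x t => -(Real.sin t * Real.sin (x * Real.sin t)))
    (fun _ => by fun_prop) (fun _ => by fun_prop) (fun y t => ?_) (fun y t => ?_) x)
  · rw [norm_neg, norm_mul]
    exact mul_le_one₀ (Real.abs_sin_le_one _) (norm_nonneg _) (Real.abs_sin_le_one _)
  · exact (hasDerivAt_mul_const (Real.sin t)).cos.congr_deriv (by ring)

theorem deriv_besselJ0 :
    deriv besselJ0 = fun x => (1 / (2 * Real.pi)) *
      ∫ t in (0 : ℝ)..(2 * Real.pi), -(Real.sin t * Real.sin (x * Real.sin t)) :=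
  funext fun x => (hasDerivAt_besselJ0 x).deriv

theorem hasDerivAt_deriv_besselJ0 (x : ℝ) :
    HasDerivAt (deriv besselJ0) ((1 / (2 * Real.pi)) *
      ∫ t in (0 : ℝ)..(2 * Real.pi), -(Real.sin t ^ 2 * Real.cos (x * Real.sin t))) x := by
  rw [deriv_besselJ0]
  refine HasDerivAt.const_mul _ (hasDerivAt_intervalIntegral_of_norm_deriv_le (C := 1)
    (F := fun x t => -(Real.sin t * Real.sin (x * Real.sin t)))
    (F' := fun x t => -(Real.sin t ^ 2 * Real.cos (x * Real.sin t)))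
    (fun _ => by fun_prop) (fun _ => by fun_prop) (fun y t => ?_) (fun y t => ?_) x)
  · rw [norm_neg, norm_mul, norm_pow]
    exact mul_le_one₀ (pow_le_one₀ (norm_nonneg _) (Real.abs_sin_le_one _)) (norm_nonneg _)
      (Real.abs_cos_le_one _)
  · exact ((hasDerivAt_mul_const (Real.sin t)).sin.const_mul (Real.sin t)).fun_neg.congr_deriv
      (by ring)

theorem integral_bessel_eq_zero (x : ℝ) :
    ∫ t in (0 : ℝ)..(2 * Real.pi), (x * -(Real.sin t ^ 2 * Real.cos (x * Real.sin t)) +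
      -(Real.sin t * Real.sin (x * Real.sin t)) + x * Real.cos (x * Real.sin t)) = 0 := by
  rw [intervalIntegral.integral_eq_sub_of_hasDerivAt
    (f := fun t => Real.cos t * Real.sin (x * Real.sin t)) (fun t _ => ?_)
    (Continuous.intervalIntegrable (by fun_prop) _ _)]
  · simp
  · refine ((Real.hasDerivAt_cos t).fun_mul
      ((Real.hasDerivAt_sin t).const_mul x).sin).congr_deriv ?_
    linear_combination (x * Real.cos (x * Real.sin t)) * Real.sin_sq_add_cos_sq t

/-- `J₀` is twice differentiable, satisfies `J₀(0) = 1`, `J₀'(0) = 0`, and solves the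
Bessel differential equation `x J₀'' + J₀' + x J₀ = 0` on `ℝ`. -/
theorem besselJ0_ode :
    Differentiable ℝ besselJ0 ∧ Differentiable ℝ (deriv besselJ0) ∧
    besselJ0 0 = 1 ∧ deriv besselJ0 0 = 0 ∧
    ∀ x : ℝ, x * deriv (deriv besselJ0) x + deriv besselJ0 x + x * besselJ0 x = 0 := by
  refine ⟨fun x => (hasDerivAt_besselJ0 x).differentiableAt,
    fun x => (hasDerivAt_deriv_besselJ0 x).differentiableAt, ?_, ?_, fun x => ?_⟩
  · simp [besselJ0]
    field_simp
  · simp [deriv_besselJ0]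
  · have h := integral_bessel_eq_zero x
    rw [intervalIntegral.integral_add (Continuous.intervalIntegrable (by fun_prop) _ _)
        (Continuous.intervalIntegrable (by fun_prop) _ _),
      intervalIntegral.integral_add (Continuous.intervalIntegrable (by fun_prop) _ _)
        (Continuous.intervalIntegrable (by fun_prop) _ _),
      intervalIntegral.integral_const_mul, intervalIntegral.integral_const_mul] at h
    rw [(hasDerivAt_deriv_besselJ0 x).deriv, (hasDerivAt_besselJ0 x).deriv, besselJ0]
    linear_combination (1 / (2 * Real.pi)) * h
end
end
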